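/- Let A be an abelian group, Γ a set of endogenies of A, and δ an endogeny of A sharply commuting with every γ ∈ Γ. If a subgroup B ≤ A is weakly Γ-invariant, then the subgroup δ[B] is weakly Γ-invariant; if B is almost Γ-invariant, then δ[B] is almost Γ-invariant. -/

import Mathlib

open Pointwise

variable {A : Type*} [AddCommGroup A]

/-- `φ` is (the underlying set of) an additive subgroup of `A × A`. -/
def IsSubgroupRel (φ : Set (A × A)) : Prop :=
  (0 : A × A) ∈ φ ∧ (∀ x ∈ φ, ∀ y ∈ φ, x + y ∈ φ) ∧ ∀ x ∈ φ, -x ∈ φ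

/-- The katakernel `kat φ = {b : (0, b) ∈ φ}`. -/
def kat (φ : Set (A × A)) : Set A := {b | ((0 : A), b) ∈ φ}

/-- The image `φ[S] = {b : ∃ a ∈ S, (a, b) ∈ φ}`. -/
def img (φ : Set (A × A)) (S : Set A) : Set A := {b | ∃ a ∈ S, (a, b) ∈ φ}

/-- An endogeny of `A`: a total additive subgroup of `A × A` with finite katakernel. -/
def IsEndogeny (φ : Set (A × A)) : Prop :=
  IsSubgroupRel φ ∧ (∀ a : A, ∃ b, (a, b) ∈ φ) ∧ (kat φ).Finite

/-- The sum `φ + ψ` of two endogenies. -/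
def esum (φ ψ : Set (A × A)) : Set (A × A) :=
  {p | ∃ b₁ b₂, (p.1, b₁) ∈ φ ∧ (p.1, b₂) ∈ ψ ∧ p.2 = b₁ + b₂}

/-- The composition `φ ∘ ψ` of two endogenies. -/
def ecomp (φ ψ : Set (A × A)) : Set (A × A) :=
  {p | ∃ b, (p.1, b) ∈ ψ ∧ (b, p.2) ∈ φ}

/-- The negation `-φ` of an endogeny. -/
def eneg (φ : Set (A × A)) : Set (A × A) := {p | (p.1, -p.2) ∈ φ}

/-- `φ` and `ψ` sharply commute if `(φ ∘ ψ - ψ ∘ φ)[A] ⊆ kat φ + kat ψ`. -/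
def SharpCommute (φ ψ : Set (A × A)) : Prop :=
  img (esum (ecomp φ ψ) (eneg (ecomp ψ φ))) Set.univ ⊆ kat φ + kat ψ

/-- `Y` has finite index in `X` (equivalently, `X` is almost contained in `Y`):
`X` is covered by finitely many translates of `Y`. -/
def AlmostIn (X Y : Set A) : Prop := ∃ F : Set A, F.Finite ∧ X ⊆ Y + F

lemma IsSubgroupRel.sub_mem {φ : Set (A × A)} (h : IsSubgroupRel φ) {a b a' b' : A}
    (h₁ : (a, b) ∈ φ) (h₂ : (a', b') ∈ φ) : (a - a', b - b') ∈ φ := by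
  simpa [sub_eq_add_neg] using h.2.1 _ h₁ _ (h.2.2 _ h₂)

lemma IsSubgroupRel.img_sub_mem {φ : Set (A × A)} (h : IsSubgroupRel φ) {S : Set A}
    (hS : ∀ x ∈ S, ∀ y ∈ S, x - y ∈ S) : ∀ x ∈ img φ S, ∀ y ∈ img φ S, x - y ∈ img φ S := by
  rintro x ⟨a, ha, hx⟩ y ⟨b, hb, hy⟩
  exact ⟨a - b, hS a ha b hb, h.sub_mem hx hy⟩

/-- If a subgroup `X` is covered by finitely many translates of `Y`, then it is covered by
finitely many translates of `X ∩ Y`. -/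
lemma AlmostIn.inter_of_sub_mem {X Y : Set A} (hX : ∀ x ∈ X, ∀ y ∈ X, x - y ∈ X)
    (hY : ∀ x ∈ Y, ∀ y ∈ Y, x - y ∈ Y) (h : AlmostIn X Y) : AlmostIn X (X ∩ Y) := by
  classical
  obtain ⟨G, hG, hXG⟩ := h
  have key : ∀ g : A, ∃ z, (∃ x ∈ X, x - g ∈ Y) → z ∈ X ∧ z - g ∈ Y := fun g => by
    by_cases hg : ∃ x ∈ X, x - g ∈ Y
    · exact hg.imp fun z hz _ => hz
    · exact ⟨0, fun h => absurd h hg⟩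
  choose r hr using key
  refine ⟨r '' G, hG.image r, fun x hx => ?_⟩
  obtain ⟨y, hy, g, hg, rfl⟩ := Set.mem_add.1 (hXG hx)
  obtain ⟨h₁, h₂⟩ := hr g ⟨y + g, hx, by simpa using hy⟩
  refine Set.mem_add.2 ⟨y + g - r g, ⟨hX _ hx _ h₁, ?_⟩, r g, ⟨g, hg, rfl⟩, by abel⟩
  have := hY _ hy _ h₂
  rwa [show y - (r g - g) = y + g - r g by abel] at this

/-- If `δ` and `γ` sharply commute, `c ∈ γ[δ[a]]` and `f ∈ δ[γ[a]]`, then `c` and `f` differ by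
an element of `kat δ + kat γ`. -/
lemma SharpCommute.exists_eq_sub_sub {δ γ : Set (A × A)} (h : SharpCommute δ γ)
    {a d c e f : A} (had : (a, d) ∈ δ) (hdc : (d, c) ∈ γ) (hae : (a, e) ∈ γ)
    (hef : (e, f) ∈ δ) : ∃ k ∈ kat δ, ∃ g ∈ kat γ, c = f - k - g := by
  have hmem : f - c ∈ kat δ + kat γ :=
    h ⟨a, trivial, f, -c, ⟨e, hae, hef⟩, ⟨d, had, by simpa using hdc⟩, sub_eq_add_neg f c⟩
  obtain ⟨k, hk, g, hg, hkg⟩ := Set.mem_add.1 hmem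
  exact ⟨k, hk, g, hg, by rw [sub_sub, hkg]; abel⟩

lemma img_img_subset_img_add_kat {δ γ : Set (A × A)} (hγ : IsEndogeny γ) (hδ : IsEndogeny δ)
    (hc : SharpCommute δ γ) {S : Set A} (hS : img γ S ⊆ S + kat γ) :
    img γ (img δ S) ⊆ img δ S + kat γ := by
  rintro c ⟨d, ⟨a, ha, had⟩, hdc⟩
  obtain ⟨e, hae⟩ := hγ.2.1 a
  obtain ⟨b, hb, x, hx, rfl⟩ := Set.mem_add.1 (hS ⟨a, ha, hae⟩)
  have hab : (a, b) ∈ γ := by simpa using hγ.1.sub_mem hae hx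
  obtain ⟨f, hbf⟩ := hδ.2.1 b
  obtain ⟨k, hk, g, hg, rfl⟩ := hc.exists_eq_sub_sub had hdc hab hbf
  exact Set.mem_add.2 ⟨f - k, ⟨b, hb, by simpa using hδ.1.sub_mem hbf hk⟩, -g,
    by simpa [kat] using hγ.1.2.2 _ hg, by abel⟩

lemma AlmostIn.img_img {δ γ : Set (A × A)} (hγ : IsEndogeny γ) (hδ : IsEndogeny δ)
    (hc : SharpCommute δ γ) {S : Set A} (hS : AlmostIn (img γ S) S) :
    AlmostIn (img γ (img δ S)) (img δ S) := by
  obtain ⟨F, hF, hFS⟩ := hS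
  choose D hD using hδ.2.1
  refine ⟨D '' F - kat γ, (hF.image D).sub hγ.2.2, ?_⟩
  rintro c ⟨d, ⟨a, ha, had⟩, hdc⟩
  obtain ⟨e, hae⟩ := hγ.2.1 a
  obtain ⟨b, hb, x, hx, rfl⟩ := Set.mem_add.1 (hFS ⟨a, ha, hae⟩)
  have hbx : (b + x, D b + D x) ∈ δ := hδ.1.2.1 _ (hD b) _ (hD x)
  obtain ⟨k, hk, g, hg, rfl⟩ := hc.exists_eq_sub_sub had hdc hae hbx
  exact Set.mem_add.2 ⟨D b - k, ⟨b, hb, by simpa using hδ.1.sub_mem (hD b) hk⟩, D x - g,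
    Set.sub_mem_sub ⟨x, hx, rfl⟩ hg, by abel⟩

theorem invariant_image (Γ : Set (Set (A × A))) (δ : Set (A × A))
    (hΓ : ∀ γ ∈ Γ, IsEndogeny γ) (hδ : IsEndogeny δ)
    (hc : ∀ γ ∈ Γ, SharpCommute δ γ) (B : AddSubgroup A) :
    ((∀ γ ∈ Γ, img γ (B : Set A) ⊆ (B : Set A) + kat γ) →
      ∀ γ ∈ Γ, img γ (img δ (B : Set A)) ⊆ img δ (B : Set A) + kat γ) ∧
    ((∀ γ ∈ Γ, AlmostIn (img γ (B : Set A)) (img γ (B : Set A) ∩ (B : Set A))) →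
      ∀ γ ∈ Γ, AlmostIn (img γ (img δ (B : Set A)))
        (img γ (img δ (B : Set A)) ∩ img δ (B : Set A))) := by
  refine ⟨fun h γ hγ => img_img_subset_img_add_kat (hΓ γ hγ) hδ (hc γ hγ) (h γ hγ),
    fun h γ hγ => ?_⟩
  have hδB := hδ.1.img_sub_mem (S := (B : Set A)) fun _ hx _ hy => B.sub_mem hx hy
  refine AlmostIn.inter_of_sub_mem ((hΓ γ hγ).1.img_sub_mem hδB) hδB ?_
  obtain ⟨F, hF, hFB⟩ := h γ hγ
  exact AlmostIn.img_img (hΓ γ hγ) hδ (hc γ hγ)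
    ⟨F, hF, hFB.trans (Set.add_subset_add_right Set.inter_subset_right)⟩
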